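/- arXiv:0908.0690 — 2 statements merged into one kernel-verified Lean document; each statement's English description precedes it below -/
import Mathlib

section
/- Let X be a complete CAT(0) space and let H₁, …, H_ℓ be subgroups of the isometry group of X that pairwise commute elementwise, i.e. a·b = b·a for all a ∈ H_i, b ∈ H_j with i ≠ j. If Fix(H_i) is nonempty for each i = 1, …, ℓ, then the intersection ⋂_{i=1}^{ℓ} Fix(H_i) is nonempty. -/
/-- `m` is a midpoint of `x` and `y`: it lies at distance `dist x y / 2` from both. -/
def IsMidpoint {X : Type*} [MetricSpace X] (x y m : X) : Prop :=
  dist x m = dist x y / 2 ∧ dist y m = dist x y / 2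

/-- A CAT(0) space, via the Bruhat–Tits (CN inequality) characterization: every pair of
points has a midpoint satisfying the CN inequality. -/
class CAT0Space (X : Type*) [MetricSpace X] : Prop where
  cn : ∀ x y : X, ∃ m : X, IsMidpoint x y m ∧
    ∀ z : X, dist z m ^ 2 ≤ dist z x ^ 2 / 2 + dist z y ^ 2 / 2 - dist x y ^ 2 / 4

open Filter Topology in
theorem aux_proj {X : Type*} [MetricSpace X] [CompleteSpace X] [CAT0Space X] (C : Set X)
    (hne : C.Nonempty) (hcl : IsClosed C)
    (hmid : ∀ x ∈ C, ∀ y ∈ C, ∀ m : X, IsMidpoint x y m →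
      (∀ z : X, dist z m ^ 2 ≤ dist z x ^ 2 / 2 + dist z y ^ 2 / 2 - dist x y ^ 2 / 4) → m ∈ C)
    (p : X) : ∃ q ∈ C, ∀ y ∈ C, dist p y ≤ dist p q → y = q := by
  set D := Metric.infDist p C with hD
  have hD0 : 0 ≤ D := Metric.infDist_nonneg
  have key : ∀ x ∈ C, ∀ y ∈ C, ∀ r : ℝ, dist p x ≤ r → dist p y ≤ r →
      dist x y ^ 2 ≤ 4 * (r ^ 2 - D ^ 2) := by
    intro x hx y hy r hxr hyr
    obtain ⟨m, hm, hcn⟩ := CAT0Space.cn x y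
    have hmC := hmid x hx y hy m hm hcn
    have h1 : D ≤ dist p m := Metric.infDist_le_dist_of_mem hmC
    have h2 := hcn p
    have h3 : D ^ 2 ≤ dist p m ^ 2 := by gcongr
    have h4 : dist p x ^ 2 ≤ r ^ 2 := by gcongr
    have h5 : dist p y ^ 2 ≤ r ^ 2 := by gcongr
    linarith
  have hseq : ∀ n : ℕ, ∃ x ∈ C, dist p x < D + 1 / ((n : ℝ) + 1) := fun n =>
    (Metric.infDist_lt_iff hne).1 (lt_add_of_pos_right D Nat.one_div_pos_of_nat)
  choose u huC hu using hseq
  have hlim : Tendsto (fun n : ℕ => D + 1 / ((n : ℝ) + 1)) atTop (𝓝 D) := by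
    simpa using (tendsto_one_div_add_atTop_nhds_zero_nat (𝕜 := ℝ)).const_add D
  have hcau : CauchySeq u := by
    refine cauchySeq_of_le_tendsto_0
      (fun n : ℕ => Real.sqrt (4 * ((D + 1 / ((n : ℝ) + 1)) ^ 2 - D ^ 2))) ?_ ?_
    · intro n m N hn hm
      apply Real.le_sqrt_of_sq_le
      apply key _ (huC n) _ (huC m)
      · exact (hu n).le.trans (by gcongr)
      · exact (hu m).le.trans (by gcongr)
    · have := (((hlim.pow 2).sub_const (D ^ 2)).const_mul 4).sqrt
      simpa using this
  obtain ⟨q, hq⟩ := cauchySeq_tendsto_of_complete hcau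
  have hqC : q ∈ C := hcl.mem_of_tendsto hq (Eventually.of_forall huC)
  have hqD : dist p q ≤ D :=
    le_of_tendsto_of_tendsto' (tendsto_const_nhds.dist hq) hlim (fun n => (hu n).le)
  refine ⟨q, hqC, fun y hy hyq => ?_⟩
  have h := key y hy q hqC D (hyq.trans hqD) hqD
  have h0 : dist y q ^ 2 = 0 := le_antisymm (by linarith) (sq_nonneg _)
  exact dist_eq_zero.1 (pow_eq_zero_iff (two_ne_zero) |>.1 h0)

theorem aux_mid {X : Type*} [MetricSpace X] (g : X ≃ᵢ X) (x y m : X) (hx : g x = x) (hy : g y = y)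
    (hm : IsMidpoint x y m)
    (hcn : ∀ z : X, dist z m ^ 2 ≤ dist z x ^ 2 / 2 + dist z y ^ 2 / 2 - dist x y ^ 2 / 4) :
    g m = m := by
  have h1 : dist (g m) x = dist x y / 2 := by
    rw [← hm.1, dist_comm x m]
    conv_lhs => rw [← hx]
    exact g.dist_eq m x
  have h2 : dist (g m) y = dist x y / 2 := by
    rw [← hm.2, dist_comm y m]
    conv_lhs => rw [← hy]
    exact g.dist_eq m y
  have h := hcn (g m)
  rw [h1, h2] at h
  have h0 : dist (g m) m ^ 2 = 0 := le_antisymm (by linarith) (sq_nonneg _)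
  exact dist_eq_zero.1 (pow_eq_zero_iff (two_ne_zero) |>.1 h0)

/-- If subgroups `H 1, …, H ℓ` of the isometry group of a complete CAT(0) space commute
elementwise pairwise and each has a nonempty fixed-point set, then the intersection of
their fixed-point sets is nonempty. -/
theorem commuting_subgroups_common_fixedPoint {X : Type*} [MetricSpace X] [CompleteSpace X]
    [CAT0Space X] {ℓ : ℕ} (hℓ : 1 ≤ ℓ) (H : Fin ℓ → Subgroup (X ≃ᵢ X))
    (hcomm : ∀ i j, i ≠ j → ∀ a ∈ H i, ∀ b ∈ H j, a * b = b * a)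
    (hfix : ∀ i, ∃ x : X, ∀ h ∈ H i, h x = x) :
    ∃ x : X, ∀ i, ∀ h ∈ H i, h x = x := by
  classical
  suffices hs : ∀ s : Finset (Fin ℓ), ∃ x : X, ∀ i ∈ s, ∀ h ∈ H i, h x = x by
    obtain ⟨x, hx⟩ := hs Finset.univ
    exact ⟨x, fun i => hx i (Finset.mem_univ i)⟩
  intro s
  induction s using Finset.induction_on with
  | empty =>
    obtain ⟨x, _⟩ := hfix ⟨0, hℓ⟩
    exact ⟨x, by simp⟩
  | insert j s hj ih =>
    obtain ⟨p, hp⟩ := hfix j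
    have hcl : IsClosed {x : X | ∀ i ∈ s, ∀ h ∈ H i, h x = x} := by
      simp only [Set.setOf_forall]
      exact isClosed_iInter fun i => isClosed_iInter fun _ => isClosed_iInter fun h =>
        isClosed_iInter fun _ => isClosed_eq h.continuous continuous_id
    obtain ⟨q, hqC, hq⟩ := aux_proj {x : X | ∀ i ∈ s, ∀ h ∈ H i, h x = x} ih hcl
      (fun x hx y hy m hm hcn i hi h hh =>
        aux_mid h x y m (hx i hi h hh) (hy i hi h hh) hm hcn) p
    refine ⟨q, fun i hi h hh => ?_⟩
    rcases Finset.mem_insert.1 hi with rfl | hi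
    · apply hq
      · intro k hk g hg
        have hne : k ≠ i := fun e => hj (e ▸ hk)
        have hc := hcomm k i hne g hg h hh
        have e : g (h q) = h (g q) := congrArg (fun f : X ≃ᵢ X => f q) hc
        rw [e, hqC k hk g hg]
      · have e := h.dist_eq p q
        rw [hp h hh] at e
        exact e.le
    · exact hqC i hi h hh
end

section
/- Let Γ be a group acting by isometries on a complete CAT(0) space X, and suppose γ ∈ Γ acts with positive translation length, i.e. |γ| := inf{ d(γ·y, y) : y ∈ X } > 0 (the infimum need not be attained, so γ may be a non-neutral parabolic). Then the image of γ in the abelianization of its centralizer Z_Γ(γ) = {g ∈ Γ : gγ = γg} has infinite order. -/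
/-- Four-point inequality: the diagonals squared are bounded by the sides squared. -/
theorem cat0_quad {X : Type*} [MetricSpace X] [CAT0Space X] (a b c d : X) :
    dist a d ^ 2 + dist b c ^ 2 ≤
      dist a c ^ 2 + dist b d ^ 2 + dist a b ^ 2 + dist c d ^ 2 := by
  obtain ⟨m, -, hm⟩ := CAT0Space.cn a d
  have h1 := hm b
  have h2 := hm c
  have h3 : dist b c ≤ dist b m + dist c m := dist_triangle_right b c m
  have h4 : dist b c ^ 2 ≤ (dist b m + dist c m) ^ 2 :=
    pow_le_pow_left₀ dist_nonneg h3 2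
  rw [dist_comm b a, dist_comm c a] at *
  nlinarith [sq_nonneg (dist b m - dist c m)]

/-- Displacement of the square of an isometry is at least twice the minimal displacement. -/
theorem cat0_double {X : Type*} [MetricSpace X] [CAT0Space X] {Γ : Type*} [Group Γ]
    [MulAction Γ X] (hiso : ∀ g : Γ, Isometry fun x : X => g • x) (g : Γ) (l : ℝ)
    (hl : ∀ y : X, l ≤ dist (g • y) y) (x : X) : 2 * l ≤ dist (g ^ 2 • x) x := by
  obtain ⟨m, ⟨-, hm1⟩, hm⟩ := CAT0Space.cn x (g • x)
  have hd : ∀ a b : X, dist (g • a) (g • b) = dist a b := fun a b => (hiso g).dist_eq a b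
  have e : g ^ 2 • x = g • g • x := by rw [pow_two, mul_smul]
  rw [e]
  have h1 := hm (g⁻¹ • m)
  have h2 := hm (g • g • x)
  have k1 : dist (g⁻¹ • m) m = dist (g • m) m := by
    rw [← hd, smul_inv_smul, dist_comm]
  have k2 : dist (g⁻¹ • m) x = dist (g • x) m := by
    rw [← hd, smul_inv_smul, dist_comm]
  have k3 : dist (g⁻¹ • m) (g • x) = dist (g • g • x) m := by
    rw [← hd, smul_inv_smul, dist_comm]
  have k4 : dist (g • g • x) (g • x) = dist x (g • x) := by rw [hd, dist_comm]
  rw [k1, k2, k3, hm1] at h1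
  rw [k4] at h2
  have h3 := hl m
  have h4 : dist (g • m) m ≤ dist (g • g • x) x / 2 := by
    refine abs_le_of_sq_le_sq' ?_ (by positivity) |>.2
    nlinarith
  linarith

theorem cat0_pow {X : Type*} [MetricSpace X] [CAT0Space X] {Γ : Type*} [Group Γ]
    [MulAction Γ X] (hiso : ∀ g : Γ, Isometry fun x : X => g • x) (g : Γ) (l : ℝ)
    (hl : ∀ y : X, l ≤ dist (g • y) y) (k : ℕ) :
    ∀ x : X, 2 ^ k * l ≤ dist (g ^ (2 ^ k) • x) x := by
  induction k with
  | zero => simpa using hl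
  | succ k ih =>
    intro x
    have := cat0_double hiso _ _ ih x
    rw [← pow_mul, ← pow_succ] at this
    rw [pow_succ (2 : ℝ)]
    linarith

/-- The subgroup of bounded real sequences. -/
def bddSeq : AddSubgroup (ℕ → ℝ) where
  carrier := {f | ∃ C, ∀ n, |f n| ≤ C}
  zero_mem' := ⟨0, by simp⟩
  add_mem' := by
    rintro a b ⟨C, hC⟩ ⟨D, hD⟩
    exact ⟨C + D, fun n => (abs_add_le _ _).trans (add_le_add (hC n) (hD n))⟩
  neg_mem' := by
    rintro a ⟨C, hC⟩
    exact ⟨C, fun n => by simpa using hC n⟩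

/-- If `γ ∈ Γ` acts on a complete CAT(0) space with positive translation length
`|γ| = inf { d(γ·y, y) : y ∈ X } > 0` (the infimum need not be attained), then the image
of `γ` in the abelianization of its centralizer `Z_Γ(γ)` has infinite order. -/
theorem ballistic_infiniteOrder_in_abelianized_centralizer {X : Type*} [MetricSpace X]
    [CompleteSpace X] [CAT0Space X] {Γ : Type*} [Group Γ] [MulAction Γ X]
    (hiso : ∀ g : Γ, Isometry fun x : X => g • x)
    (γ : Γ)
    (hpos : 0 < sInf (Set.range fun y : X => dist (γ • y) y)) :
    ¬ IsOfFinOrder (Abelianization.of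
      (⟨γ, by simp [Subgroup.mem_centralizer_iff]⟩ :
        Subgroup.centralizer ({γ} : Set Γ))) := by
  obtain ⟨x⟩ : Nonempty X := by
    by_contra h
    rw [not_nonempty_iff] at h
    simp [Set.range_eq_empty] at hpos
  set l := sInf (Set.range fun y : X => dist (γ • y) y) with hl_def
  have hl : ∀ y : X, l ≤ dist (γ • y) y := fun y =>
    csInf_le ⟨0, by rintro _ ⟨z, rfl⟩; exact dist_nonneg⟩ ⟨y, rfl⟩
  have hd : ∀ (g : Γ) (a b : X), dist (g • a) (g • b) = dist a b :=
    fun g a b => (hiso g).dist_eq a b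
  let F : Γ → ℕ → ℝ := fun g n => dist (g • x) (γ ^ n • x) ^ 2 - dist x (γ ^ n • x) ^ 2
  have key : ∀ g h : Γ, g * γ = γ * g → F (g * h) - (F g + F h) ∈ bddSeq := by
    intro g h hg
    refine ⟨dist (h • x) x ^ 2 + dist (g • x) x ^ 2, fun n => ?_⟩
    have hc : g * γ ^ n = γ ^ n * g := (show Commute g γ from hg).pow_right n
    have e1 : dist (g • γ ^ n • x) (γ ^ n • x) = dist (g • x) x := by
      rw [← mul_smul, hc, mul_smul, hd]
    have q1 := cat0_quad ((g * h) • x) (g • x) (γ ^ n • x) (g • γ ^ n • x)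
    have q2 := cat0_quad (g • x) ((g * h) • x) (γ ^ n • x) (g • γ ^ n • x)
    rw [dist_comm (γ ^ n • x) (g • γ ^ n • x), e1] at q1 q2
    simp only [mul_smul, hd] at q1 q2
    rw [dist_comm x (h • x)] at q2
    simp only [F, Pi.sub_apply, Pi.add_apply, mul_smul]
    rw [abs_le]
    constructor <;> linarith
  let χ : Subgroup.centralizer ({γ} : Set Γ) →* Multiplicative ((ℕ → ℝ) ⧸ bddSeq) :=
    MonoidHom.mk' (fun g => Multiplicative.ofAdd (QuotientAddGroup.mk (F g.1))) (by
      intro g h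
      rw [← ofAdd_add, ← QuotientAddGroup.mk_add]
      congr 1
      rw [eq_comm, QuotientAddGroup.eq]
      have hg : g.1 * γ = γ * g.1 :=
        (Subgroup.mem_centralizer_iff.1 g.2 γ rfl).symm
      have := key g.1 h.1 hg
      rwa [sub_eq_neg_add] at this)
  intro hfin
  have hfin2 := (Abelianization.lift χ).isOfFinOrder hfin
  rw [Abelianization.lift_apply_of] at hfin2
  obtain ⟨k, hk, hk1⟩ := isOfFinOrder_iff_pow_eq_one.1 hfin2
  have hk2 : k • F γ ∈ bddSeq := by
    rw [← QuotientAddGroup.eq_zero_iff]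
    exact hk1
  obtain ⟨C, hC⟩ := hk2
  have hstep : ∀ n, dist x (γ ^ (n + 1) • x) ^ 2 ≤ dist x (γ ^ n • x) ^ 2 + C := by
    intro n
    have h1 := hC (n + 1)
    have e : dist (γ • x) (γ ^ (n + 1) • x) = dist x (γ ^ n • x) := by
      rw [pow_succ', mul_smul, hd]
    simp only [Pi.smul_apply, F, e, nsmul_eq_mul, abs_mul, Nat.abs_cast] at h1
    have hk3 : (1 : ℝ) ≤ k := by exact_mod_cast hk
    have h2 := neg_abs_le (dist x (γ ^ n • x) ^ 2 - dist x (γ ^ (n + 1) • x) ^ 2)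
    have h3 := le_mul_of_one_le_left
      (abs_nonneg (dist x (γ ^ n • x) ^ 2 - dist x (γ ^ (n + 1) • x) ^ 2)) hk3
    linarith
  have hlin : ∀ n : ℕ, dist x (γ ^ n • x) ^ 2 ≤ n * C := by
    intro n
    induction n with
    | zero => simp
    | succ n ih =>
      have := hstep n
      push_cast
      linarith
  have hl2 : 0 < l ^ 2 := by positivity
  obtain ⟨j, hj⟩ := pow_unbounded_of_one_lt (C / l ^ 2) (one_lt_two)
  rw [div_lt_iff₀ hl2] at hj
  have h1 := cat0_pow hiso γ l hl j x
  have h2 := hlin (2 ^ j)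
  rw [dist_comm] at h1
  have hp : (0 : ℝ) < 2 ^ j := by positivity
  have h3 := pow_le_pow_left₀ (by positivity) h1 2
  push_cast at h2
  nlinarith [mul_lt_mul_of_pos_left hj hp]
end
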